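/- arXiv:2206.11426 — 8 statements merged into one kernel-verified Lean document; each statement's English description precedes it below -/
import Mathlib

section
/- Let E be a real inner product space, C ⊆ E, and φ, ψ : E → ℝ. Fix x ∈ C and L ≥ 0, and suppose the approximation error θ := ψ − φ is differentiable with L-Lipschitz gradient and satisfies θ(x) = 0 and ∇θ(x) = 0. If z′ ∈ C minimizes ψ over C and ψ(z′) ≥ φ(z′), then φ(z′) ≤ φ(z) + (L/2)‖x − z‖² for every z ∈ C. -/
open scoped RealInnerProductSpace

/-- The descent lemma: a differentiable function whose gradient is `L`-Lipschitz relative to `x`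
lies below its quadratic upper model at `x`. -/
theorem HasGradientAt.le_add_inner_add_sq {E : Type*} [NormedAddCommGroup E]
    [InnerProductSpace ℝ E] [CompleteSpace E] {g : E → ℝ} {g' : E → E} {L : ℝ} {x : E}
    (hg : ∀ u, HasGradientAt g (g' u) u) (hlip : ∀ u, ‖g' u - g' x‖ ≤ L * ‖u - x‖) (y : E) :
    g y ≤ g x + inner ℝ (g' x) (y - x) + L / 2 * ‖y - x‖ ^ 2 := by
  have hline (t : ℝ) : HasDerivAt (fun t : ℝ => g (x + t • (y - x)))
      (inner ℝ (g' (x + t • (y - x))) (y - x)) t := by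
    have hpath : HasDerivAt (fun t : ℝ => x + t • (y - x)) (y - x) t := by
      simpa using ((hasDerivAt_id t).smul_const (y - x)).const_add x
    simpa [Function.comp_def] using (hg (x + t • (y - x))).hasFDerivAt.comp_hasDerivAt t hpath
  have hmodel (t : ℝ) : HasDerivAt
      (fun t : ℝ => g x + t * inner ℝ (g' x) (y - x) + L / 2 * ‖y - x‖ ^ 2 * t ^ 2)
      (inner ℝ (g' x) (y - x) + L * ‖y - x‖ ^ 2 * t) t := by
    refine ((((hasDerivAt_id t).mul_const (inner ℝ (g' x) (y - x))).const_add (g x)).add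
      (((hasDerivAt_id t).pow 2).const_mul (L / 2 * ‖y - x‖ ^ 2))).congr_deriv ?_
    simp
    ring
  have hle := image_le_of_deriv_right_le_deriv_boundary (a := 0) (b := 1)
    (fun t _ => (hline t).continuousAt.continuousWithinAt)
    (fun t _ => (hline t).hasDerivWithinAt) (by simp)
    (fun t _ => (hmodel t).continuousAt.continuousWithinAt)
    (fun t _ => (hmodel t).hasDerivWithinAt) ?_ (Set.right_mem_Icc.2 zero_le_one)
  · simpa using hle
  · intro t ht
    rw [← sub_le_iff_le_add', ← inner_sub_left]
    calc inner ℝ (g' (x + t • (y - x)) - g' x) (y - x)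
        ≤ ‖g' (x + t • (y - x)) - g' x‖ * ‖y - x‖ := real_inner_le_norm _ _
      _ ≤ L * ‖x + t • (y - x) - x‖ * ‖y - x‖ := by gcongr; exact hlip _
      _ = L * ‖y - x‖ ^ 2 * t := by
        rw [add_sub_cancel_left, norm_smul, Real.norm_of_nonneg ht.1]
        ring

/-- Part (2) of the lemma on first-order surrogates: if the error `θ = ψ - φ` is
`L`-smooth and vanishes to first order at `x ∈ C`, and `z'` minimizes `ψ` over `C`
with `ψ z' ≥ φ z'`, then `φ z' ≤ φ z + (L/2)‖x - z‖²` for every `z ∈ C`. -/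
theorem statement1 {E : Type*} [NormedAddCommGroup E] [InnerProductSpace ℝ E] [CompleteSpace E]
    (C : Set E) (φ ψ : E → ℝ) (x : E) (hxC : x ∈ C)
    (L : ℝ) (hL : 0 ≤ L) (θ' : E → E)
    (hdiff : ∀ u : E, HasGradientAt (fun w => ψ w - φ w) (θ' u) u)
    (hlip : ∀ u v : E, ‖θ' u - θ' v‖ ≤ L * ‖u - v‖)
    (hθx : ψ x - φ x = 0) (hθ'x : θ' x = 0)
    (z' : E) (hz'C : z' ∈ C) (hmin : ∀ z ∈ C, ψ z' ≤ ψ z) (hmaj : φ z' ≤ ψ z') :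
    ∀ z ∈ C, φ z' ≤ φ z + L / 2 * ‖x - z‖ ^ 2 := by
  intro z hz
  have hdescent := HasGradientAt.le_add_inner_add_sq hdiff (fun u => hlip u x) z
  rw [hθx, hθ'x, inner_zero_left, norm_sub_rev] at hdescent
  linarith [hmin z hz]
end

section
/- Let E be a real inner product space, C ⊆ E a convex set, h : E → ℝ convex and differentiable with L-Lipschitz gradient, f : E → ℝ, and set φ := f − h. Suppose: y ∈ C, and x′ ∈ C minimizes the majorant x ↦ f(x) − h(y) − ⟨∇h(y), x − y⟩ over C. Then φ(x′) ≤ φ(x) + (L/2)‖x − y‖² for every x ∈ C. In particular (taking x = y), φ(x′) ≤ φ(y), so the CCCP iterates produce a monotonically nonincreasing sequence of objective values. -/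
open scoped RealInnerProductSpace

/-- The derivative of a function along a line, in terms of its gradient. -/
lemma HasGradientAt.hasDerivAt_add_smul {E : Type*} [NormedAddCommGroup E]
    [InnerProductSpace ℝ E] [CompleteSpace E] {h : E → ℝ} {g y v : E} {t : ℝ}
    (hg : HasGradientAt h g (y + t • v)) :
    HasDerivAt (fun s : ℝ => h (y + s • v)) ⟪g, v⟫ t := by
  have hline : HasDerivAt (fun s : ℝ => y + s • v) v t := by
    simpa using ((hasDerivAt_id t).smul_const v).const_add y
  simpa [Function.comp_def] using hg.hasFDerivAt.comp_hasDerivAt t hline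

/-- A convex function lies above its tangent hyperplanes. -/
lemma ConvexOn.add_inner_gradient_le {E : Type*} [NormedAddCommGroup E]
    [InnerProductSpace ℝ E] [CompleteSpace E] {h : E → ℝ} {g y : E}
    (hconv : ConvexOn ℝ Set.univ h) (hg : HasGradientAt h g y) (x : E) :
    h y + ⟪g, x - y⟫ ≤ h x := by
  have hline : ConvexOn ℝ Set.univ (fun s : ℝ => h (y + s • (x - y))) := by
    simpa [Function.comp_def, AffineMap.lineMap_apply, add_comm] using
      hconv.comp_affineMap (AffineMap.lineMap y x : ℝ →ᵃ[ℝ] E)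
  have hderiv : HasDerivAt (fun s : ℝ => h (y + s • (x - y))) ⟪g, x - y⟫ 0 :=
    HasGradientAt.hasDerivAt_add_smul (by simpa using hg)
  have := hline.le_slope_of_hasDerivAt (Set.mem_univ 0) (Set.mem_univ 1) zero_lt_one hderiv
  simp [slope_def_field] at this
  linarith

/-- The quadratic upper bound (descent lemma) for a function with Lipschitz gradient. -/
lemma le_add_inner_add_sq_of_lipschitz_gradient {E : Type*} [NormedAddCommGroup E]
    [InnerProductSpace ℝ E] [CompleteSpace E] {h : E → ℝ} {h' : E → E} {L : ℝ}
    (hdiff : ∀ u : E, HasGradientAt h (h' u) u)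
    (hlip : ∀ u v : E, ‖h' u - h' v‖ ≤ L * ‖u - v‖) (x y : E) :
    h x ≤ h y + ⟪h' y, x - y⟫ + L / 2 * ‖x - y‖ ^ 2 := by
  set v := x - y with hv
  have hderiv (t : ℝ) : HasDerivAt
      (fun s : ℝ => h (y + s • v) - s * ⟪h' y, v⟫ - L / 2 * ‖v‖ ^ 2 * s ^ 2)
      (⟪h' (y + t • v), v⟫ - ⟪h' y, v⟫ - L * t * ‖v‖ ^ 2) t := by
    refine (((hdiff (y + t • v)).hasDerivAt_add_smul.sub
      ((hasDerivAt_id t).mul_const ⟪h' y, v⟫)).sub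
      ((hasDerivAt_pow 2 t).const_mul (L / 2 * ‖v‖ ^ 2))).congr_deriv ?_
    push_cast
    ring
  have hanti := antitoneOn_of_deriv_nonpos (convex_Icc (0 : ℝ) 1)
    (fun t _ => (hderiv t).continuousAt.continuousWithinAt)
    (fun t _ => (hderiv t).differentiableAt.differentiableWithinAt) (fun t ht => by
      rw [interior_Icc] at ht
      rw [(hderiv t).deriv, ← inner_sub_left, sub_nonpos]
      calc ⟪h' (y + t • v) - h' y, v⟫
          ≤ ‖h' (y + t • v) - h' y‖ * ‖v‖ := real_inner_le_norm _ _
        _ ≤ L * ‖y + t • v - y‖ * ‖v‖ := by gcongr; exact hlip _ _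
        _ = L * t * ‖v‖ ^ 2 := by
          rw [add_sub_cancel_left, norm_smul, Real.norm_of_nonneg ht.1.le]
          ring)
  have := hanti (Set.left_mem_Icc.2 zero_le_one) (Set.right_mem_Icc.2 zero_le_one) zero_le_one
  simp [hv] at this
  linarith

/-- Per-iteration inequality of CCCP: if `x'` minimizes the majorant
`x ↦ f x - h y - ⟪∇h y, x - y⟫` over `C`, then with `φ = f - h` we have
`φ x' ≤ φ x + (L/2)‖x - y‖²` for all `x ∈ C`; in particular `φ x' ≤ φ y`. -/
theorem statement3 {E : Type*} [NormedAddCommGroup E] [InnerProductSpace ℝ E] [CompleteSpace E]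
    (C : Set E) (hC : Convex ℝ C) (L : ℝ) (hL : 0 ≤ L)
    (f h : E → ℝ) (h' : E → E)
    (hconv : ConvexOn ℝ Set.univ h)
    (hdiff : ∀ u : E, HasGradientAt h (h' u) u)
    (hlip : ∀ u v : E, ‖h' u - h' v‖ ≤ L * ‖u - v‖)
    (y : E) (hy : y ∈ C) (x' : E) (hx' : x' ∈ C)
    (hmin : ∀ x ∈ C,
      f x' - h y - ⟪h' y, x' - y⟫ ≤ f x - h y - ⟪h' y, x - y⟫) :
    (∀ x ∈ C, f x' - h x' ≤ f x - h x + L / 2 * ‖x - y‖ ^ 2) ∧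
      f x' - h x' ≤ f y - h y := by
  have hquad (x : E) (hx : x ∈ C) :
      f x' - h x' ≤ f x - h x + L / 2 * ‖x - y‖ ^ 2 := by
    have := hconv.add_inner_gradient_le (hdiff y) x'
    have := le_add_inner_add_sq_of_lipschitz_gradient hdiff hlip x y
    linarith [hmin x hx]
  exact ⟨hquad, by simpa using hquad y hy⟩
end

section
/- Let E be a real inner product space, C ⊆ E a convex set, h : E → ℝ convex and differentiable with L-Lipschitz gradient, f : E → ℝ, and set φ := f − h. Assume φ is convex on C, x* ∈ C minimizes φ over C, and there is R ≥ 0 with ‖x − x*‖ ≤ R for all x ∈ C. Let x₀ ∈ C and, for each k ≥ 0, let x_{k+1} ∈ C be a minimizer over C of the majorant x ↦ f(x) − h(x_k) − ⟨∇h(x_k), x − x_k⟩. Then for every k ≥ 1, φ(x_k) − φ(x*) ≤ 2LR²/(k+2). -/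
open scoped RealInnerProductSpace

section Gradient

variable {E : Type*} [NormedAddCommGroup E] [InnerProductSpace ℝ E] [CompleteSpace E]

theorem HasGradientAt.hasDerivAt_comp_add_smul {h : E → ℝ} {g u d : E} {t : ℝ}
    (hg : HasGradientAt h g (u + t • d)) :
    HasDerivAt (fun s : ℝ => h (u + s • d)) ⟪g, d⟫ t := by
  have hline : HasDerivAt (fun s : ℝ => u + s • d) d t := by
    simpa using ((hasDerivAt_id t).smul_const d).const_add u
  simpa [Function.comp_def] using HasFDerivAt.comp_hasDerivAt t hg.hasFDerivAt hline

/-- The first-order characterization of convexity: the graph lies above its tangents. -/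
theorem ConvexOn.inner_le_sub_of_hasGradientAt {h : E → ℝ} {g u : E}
    (hconv : ConvexOn ℝ Set.univ h) (hg : HasGradientAt h g u) (v : E) :
    ⟪g, v - u⟫ ≤ h v - h u := by
  have hd : HasDerivAt (fun s : ℝ => h (u + s • (v - u))) ⟪g, v - u⟫ 0 :=
    HasGradientAt.hasDerivAt_comp_add_smul (by simpa using hg)
  have hc : ConvexOn ℝ Set.univ (fun s : ℝ => h (u + s • (v - u))) := by
    have := hconv.comp_affineMap (AffineMap.lineMap (k := ℝ) u v)
    simpa [Function.comp_def, AffineMap.lineMap_apply, add_comm] using this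
  have := hc.le_slope_of_hasDerivAt (Set.mem_univ 0) (Set.mem_univ 1) one_pos hd
  simpa [slope_def_field] using this

/-- The descent lemma for functions with an `L`-Lipschitz gradient. -/
theorem sub_sub_inner_le_of_lipschitz_gradient {h : E → ℝ} {h' : E → E} {L : ℝ}
    (hdiff : ∀ u, HasGradientAt h (h' u) u) (hlip : ∀ u v, ‖h' u - h' v‖ ≤ L * ‖u - v‖)
    (u v : E) : h v - h u - ⟪h' u, v - u⟫ ≤ L / 2 * ‖v - u‖ ^ 2 := by
  set d := v - u with hd
  have hder (t : ℝ) : HasDerivAt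
      (fun s : ℝ => L / 2 * ‖d‖ ^ 2 * s ^ 2 + s * ⟪h' u, d⟫ - h (u + s • d))
      (L * ‖d‖ ^ 2 * t + ⟪h' u, d⟫ - ⟪h' (u + t • d), d⟫) t := by
    refine ((((hasDerivAt_pow 2 t).const_mul (L / 2 * ‖d‖ ^ 2)).add
      ((hasDerivAt_id t).mul_const ⟪h' u, d⟫)).sub
      (hdiff (u + t • d)).hasDerivAt_comp_add_smul).congr_deriv ?_
    push_cast
    ring
  have hmono := monotoneOn_of_hasDerivWithinAt_nonneg (convex_Icc (0 : ℝ) 1)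
    (fun t _ => (hder t).continuousAt.continuousWithinAt)
    (fun t _ => (hder t).hasDerivWithinAt) (fun t ht => by
      rw [interior_Icc] at ht
      have h1 : ⟪h' (u + t • d) - h' u, d⟫ ≤ L * (t * ‖d‖) * ‖d‖ := by
        refine (real_inner_le_norm _ _).trans ?_
        gcongr
        simpa [norm_smul, abs_of_pos ht.1] using hlip (u + t • d) u
      rw [inner_sub_left] at h1
      linarith)
  have := hmono (Set.left_mem_Icc.2 zero_le_one) (Set.right_mem_Icc.2 zero_le_one) zero_le_one
  simp [hd] at this ⊢
  linarith

end Gradient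

/-- Main non-asymptotic convergence theorem for CCCP in the flat case: for `φ = f - h`
convex on a convex bounded feasible set `C`, with `h` convex and `L`-smooth, the CCCP
iterates (each minimizing the linearized majorant over `C`) satisfy
`φ(x_k) - φ(x*) ≤ 2LR²/(k+2)` for all `k ≥ 1`. -/
theorem statement4 {E : Type*} [NormedAddCommGroup E] [InnerProductSpace ℝ E] [CompleteSpace E]
    (C : Set E) (hC : Convex ℝ C) (L : ℝ) (hL : 0 ≤ L)
    (f h : E → ℝ) (h' : E → E)
    (hconv : ConvexOn ℝ Set.univ h)
    (hdiff : ∀ u : E, HasGradientAt h (h' u) u)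
    (hlip : ∀ u v : E, ‖h' u - h' v‖ ≤ L * ‖u - v‖)
    (hφconv : ConvexOn ℝ C (fun z => f z - h z))
    (xs : E) (hxs : xs ∈ C) (hxsmin : ∀ z ∈ C, f xs - h xs ≤ f z - h z)
    (R : ℝ) (hR : 0 ≤ R) (hbound : ∀ z ∈ C, ‖z - xs‖ ≤ R)
    (x : ℕ → E) (hxC : ∀ k, x k ∈ C)
    (hstep : ∀ k : ℕ, ∀ z ∈ C,
      f (x (k + 1)) - h (x k) - ⟪h' (x k), x (k + 1) - x k⟫
        ≤ f z - h (x k) - ⟪h' (x k), z - x k⟫) :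
    ∀ k : ℕ, 1 ≤ k →
      f (x k) - h (x k) - (f xs - h xs) ≤ 2 * L * R ^ 2 / ((k : ℝ) + 2) := by
  have hgap (k : ℕ) (z : E) (hz : z ∈ C) :
      f (x (k + 1)) - h (x (k + 1)) ≤ f z - h z + L / 2 * ‖z - x k‖ ^ 2 := by
    have h1 := hconv.inner_le_sub_of_hasGradientAt (hdiff (x k)) (x (k + 1))
    have h2 := sub_sub_inner_le_of_lipschitz_gradient hdiff hlip (x k) z
    have h3 := hstep k z hz
    linarith
  have hrec (k : ℕ) (t : ℝ) (ht0 : 0 ≤ t) (ht1 : t ≤ 1) :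
      f (x (k + 1)) - h (x (k + 1)) - (f xs - h xs) ≤
        (1 - t) * (f (x k) - h (x k) - (f xs - h xs)) + L / 2 * (t * R) ^ 2 := by
    have h1 := hgap k _ (hC (hxC k) hxs (sub_nonneg.2 ht1) ht0 (sub_add_cancel 1 t))
    have h2 := hφconv.2 (hxC k) hxs (sub_nonneg.2 ht1) ht0 (sub_add_cancel 1 t)
    have h3 : ‖(1 - t) • x k + t • xs - x k‖ ≤ t * R := by
      rw [show (1 - t) • x k + t • xs - x k = t • (xs - x k) by module, norm_smul,
        Real.norm_of_nonneg ht0, norm_sub_rev]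
      exact mul_le_mul_of_nonneg_left (hbound _ (hxC k)) ht0
    have h4 : L / 2 * ‖(1 - t) • x k + t • xs - x k‖ ^ 2 ≤ L / 2 * (t * R) ^ 2 := by gcongr
    simp only [smul_eq_mul] at h2
    linarith
  have hmul (k : ℕ) (hk : (k : ℝ) * (f (x k) - h (x k) - (f xs - h xs)) ≤
      k * (2 * L * R ^ 2 / (k + 2))) :
      f (x (k + 1)) - h (x (k + 1)) - (f xs - h xs) ≤
        2 * L * R ^ 2 / (((k + 1 : ℕ) : ℝ) + 2) := by
    have hLR : 0 ≤ L * R ^ 2 := by positivity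
    have hk2 : (0 : ℝ) < k + 2 := by positivity
    calc _ ≤ _ := hrec k (2 / (k + 2)) (by positivity) (by rw [div_le_one hk2]; simp)
      _ = k * (f (x k) - h (x k) - (f xs - h xs)) / (k + 2)
          + L / 2 * (2 / (k + 2) * R) ^ 2 := by field_simp; ring
      _ ≤ k * (2 * L * R ^ 2 / (k + 2)) / (k + 2)
          + L / 2 * (2 / (k + 2) * R) ^ 2 := by gcongr
      _ = 2 * (L * R ^ 2) * (k + 1) / (k + 2) ^ 2 := by field_simp
      _ ≤ _ := by
        push_cast
        rw [div_le_div_iff₀ (by positivity) (by positivity)]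
        nlinarith
  intro k hk
  induction k, hk using Nat.le_induction with
  | base => exact hmul 0 (by simp)
  | succ k _ ih => exact hmul k (by gcongr)
end

section
/- Let E be a real inner product space, C ⊆ E a convex set, φ : E → ℝ convex on C, x* ∈ C a minimizer of φ over C, and R ≥ 0 with ‖x − x*‖ ≤ R for all x ∈ C. Let L ≥ 0 and ε ≥ 0, and let (x_k)_{k≥0} be a sequence in C such that for every k ≥ 1 and every x ∈ C, φ(x_k) ≤ φ(x) + (L(1+ε)/2)‖x − x_{k−1}‖². Then for every k ≥ 1, φ(x_k) − φ(x*) ≤ 2LR²(1+ε)/(k+2). -/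
/-- One step of the descent inequality, tested at the point of the segment from `y` to `xs`
with parameter `s`. -/
theorem ConvexOn.gap_le_of_approx_descent {E : Type*} [NormedAddCommGroup E] [NormedSpace ℝ E]
    {C : Set E} {φ : E → ℝ} (hφ : ConvexOn ℝ C φ) {xs y : E} (hxs : xs ∈ C) (hy : y ∈ C)
    {R M v : ℝ} (hM : 0 ≤ M) (hyR : ‖y - xs‖ ≤ R)
    (hv : ∀ z ∈ C, v ≤ φ z + M / 2 * ‖z - y‖ ^ 2) {s : ℝ} (hs0 : 0 ≤ s) (hs1 : s ≤ 1) :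
    v - φ xs ≤ (1 - s) * (φ y - φ xs) + s ^ 2 * (M * R ^ 2) / 2 := by
  have hs : 0 ≤ 1 - s := by linarith
  have hdist : ‖(1 - s) • y + s • xs - y‖ = s * ‖y - xs‖ := by
    rw [show (1 - s) • y + s • xs - y = (-s) • (y - xs) by module, norm_smul, norm_neg,
      Real.norm_of_nonneg hs0]
  have hval := hv _ (hφ.1 hy hxs hs hs0 (by ring))
  have hconv := hφ.2 hy hxs hs hs0 (by ring)
  rw [hdist] at hval
  simp only [smul_eq_mul] at hconv
  have hsq : M / 2 * (s * ‖y - xs‖) ^ 2 ≤ M / 2 * (s * R) ^ 2 := by gcongr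
  linarith

/-- A sequence with `δ (n + 1) ≤ (1 - s) * δ n + s² D / 2` for all `s ∈ [0, 1]` decays like
`2 D / (n + 2)`. -/
theorem le_two_mul_div_of_quadratic_recursion {δ : ℕ → ℝ} {D : ℝ} (hD : 0 ≤ D)
    (h : ∀ n, ∀ s : ℝ, 0 ≤ s → s ≤ 1 → δ (n + 1) ≤ (1 - s) * δ n + s ^ 2 * D / 2) (n : ℕ) :
    δ (n + 1) ≤ 2 * D / ((n : ℝ) + 3) := by
  induction n with
  | zero =>
    have := h 0 1 zero_le_one le_rfl
    norm_num at this ⊢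
    linarith
  | succ n ih =>
    have hn : (0 : ℝ) ≤ n := n.cast_nonneg
    have hs1 : 2 / ((n : ℝ) + 4) ≤ 1 := by
      rw [div_le_one (by positivity)]
      linarith
    have hstep := h (n + 1) (2 / ((n : ℝ) + 4)) (by positivity) hs1
    have hmul := mul_le_mul_of_nonneg_left ih (sub_nonneg.2 hs1)
    have hgap : 2 * D / ((n : ℝ) + 4) - ((1 - 2 / ((n : ℝ) + 4)) * (2 * D / ((n : ℝ) + 3))
        + (2 / ((n : ℝ) + 4)) ^ 2 * D / 2) = 2 * D / (((n : ℝ) + 3) * ((n : ℝ) + 4) ^ 2) := by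
      field_simp
      ring
    have hpos : 0 ≤ 2 * D / (((n : ℝ) + 3) * ((n : ℝ) + 4) ^ 2) := by positivity
    have hcast : ((n + 1 : ℕ) : ℝ) + 3 = n + 4 := by
      push_cast
      ring
    rw [hcast]
    linarith

/-- Convergence of CCCP with an inexact oracle in the flat case: if each iterate
satisfies the approximate descent inequality
`φ(x_k) ≤ φ(x) + (L(1+ε)/2)‖x - x_{k-1}‖²` for all `x ∈ C`, then
`φ(x_k) - φ(x*) ≤ 2LR²(1+ε)/(k+2)` for all `k ≥ 1`. -/
theorem statement5 {E : Type*} [NormedAddCommGroup E] [InnerProductSpace ℝ E]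
    (C : Set E) (hC : Convex ℝ C) (φ : E → ℝ) (hφconv : ConvexOn ℝ C φ)
    (xs : E) (hxs : xs ∈ C) (hxsmin : ∀ z ∈ C, φ xs ≤ φ z)
    (R : ℝ) (hR : 0 ≤ R) (hbound : ∀ z ∈ C, ‖z - xs‖ ≤ R)
    (L ε : ℝ) (hL : 0 ≤ L) (hε : 0 ≤ ε)
    (x : ℕ → E) (hxC : ∀ k, x k ∈ C)
    (hdesc : ∀ k : ℕ, 1 ≤ k → ∀ z ∈ C,
      φ (x k) ≤ φ z + L * (1 + ε) / 2 * ‖z - x (k - 1)‖ ^ 2) :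
    ∀ k : ℕ, 1 ≤ k →
      φ (x k) - φ xs ≤ 2 * L * R ^ 2 * (1 + ε) / ((k : ℝ) + 2) := by
  intro k hk
  obtain ⟨n, rfl⟩ := Nat.exists_eq_add_of_le' hk
  have hM : 0 ≤ L * (1 + ε) := by positivity
  have hrate := le_two_mul_div_of_quadratic_recursion (δ := fun k => φ (x k) - φ xs)
    (D := L * (1 + ε) * R ^ 2) (by positivity)
    (fun m _ hs0 hs1 => hφconv.gap_le_of_approx_descent hxs (hxC m) hM (hbound _ (hxC m))
      (hdesc (m + 1) (Nat.le_add_left 1 m)) hs0 hs1) n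
  refine hrate.trans_eq ?_
  push_cast
  ring
end

section
/- For every real x > 0, the function t ↦ (log(1+tx) + log(t+x) − log x − 2·log(1+t))/t is integrable on (0, ∞), and ∫₀^∞ (log(1+tx) + log(t+x) − log x − 2·log(1+t)) dt/t = (log x)². -/
open MeasureTheory Set Filter Topology

/-- For `s ≥ 1` the rational kernel `(s² - 1) / (s (t + s) (1 + t s))` is dominated on
`s ∈ [1, x]`, `t > 0` by `x / (1 + t)²`. -/
lemma logSqKernel_le {s t x : ℝ} (hs : 1 ≤ s) (hsx : s ≤ x) (ht : 0 < t) :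
    (s ^ 2 - 1) / (s * (t + s) * (1 + t * s)) ≤ x * ((1 + t) ^ 2)⁻¹ := by
  have hs0 : 0 < s := by linarith
  have h1 : (1 + t) ^ 2 ≤ (t + s) * (1 + t * s) := by
    rw [sq]
    exact mul_le_mul (by linarith) (by nlinarith) (by positivity) (by positivity)
  calc (s ^ 2 - 1) / (s * (t + s) * (1 + t * s))
      ≤ (s * s) / (s * (1 + t) ^ 2) := by
        apply div_le_div₀ (by positivity) (by nlinarith) (by positivity)
        rw [mul_assoc]
        exact mul_le_mul_of_nonneg_left h1 hs0.le
    _ = s * ((1 + t) ^ 2)⁻¹ := by field_simp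
    _ ≤ x * ((1 + t) ^ 2)⁻¹ := by gcongr

lemma logSqKernel_nonneg {s t : ℝ} (hs : 1 ≤ s) (ht : 0 < t) :
    0 ≤ (s ^ 2 - 1) / (s * (t + s) * (1 + t * s)) := by
  have hs0 : 0 < s := by linarith
  have : 0 ≤ s ^ 2 - 1 := by nlinarith
  positivity

lemma integrableOn_inv_one_add_sq_Ioi :
    IntegrableOn (fun t : ℝ => ((1 + t) ^ 2)⁻¹) (Ioi 0) := by
  refine integrableOn_Ioi_deriv_of_nonneg' (g := fun t : ℝ => -(1 + t)⁻¹) (l := 0) ?_ ?_ ?_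
  · intro t ht
    have h : (1 + t) ≠ 0 := by have := mem_Ici.1 ht; linarith
    refine HasDerivAt.congr_deriv ((((hasDerivAt_id t).const_add 1).inv h).neg) ?_
    simp [div_eq_mul_inv]
  · intro t _
    positivity
  · have : Tendsto (fun t : ℝ => (1 + t)⁻¹) atTop (𝓝 0) :=
      tendsto_inv_atTop_zero.comp (tendsto_atTop_add_const_left _ _ tendsto_id)
    simpa using this.neg

/-- Integrating the kernel in `t` over `(0, ∞)`. -/
lemma integral_logSqKernel_Ioi {s : ℝ} (hs : 1 ≤ s) :
    ∫ t in Ioi (0 : ℝ), (s ^ 2 - 1) / (s * (t + s) * (1 + t * s)) = 2 * Real.log s / s := by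
  have hs0 : 0 < s := by linarith
  have key := integral_Ioi_of_hasDerivAt_of_nonneg' (a := 0)
    (g := fun t : ℝ => (Real.log (1 + t * s) - Real.log (t + s)) / s)
    (g' := fun t : ℝ => (s ^ 2 - 1) / (s * (t + s) * (1 + t * s)))
    (l := Real.log s / s) ?_ ?_ ?_
  · rw [key]
    simp
    ring
  · intro t ht
    have ht : 0 ≤ t := ht
    have h1 : 1 + t * s ≠ 0 := by positivity
    have h2 : t + s ≠ 0 := by positivity
    have d1 : HasDerivAt (fun t : ℝ => 1 + t * s) s t := by
      simpa using ((hasDerivAt_id t).mul_const s).const_add 1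
    have d2 : HasDerivAt (fun t : ℝ => t + s) 1 t := (hasDerivAt_id t).add_const s
    refine HasDerivAt.congr_deriv (((d1.log h1).sub (d2.log h2)).div_const s) ?_
    field_simp
    ring
  · intro t ht
    exact logSqKernel_nonneg hs ht
  · apply Tendsto.div_const
    have h0 : Tendsto (fun t : ℝ => (t + s)⁻¹) atTop (𝓝 0) :=
      tendsto_inv_atTop_zero.comp (tendsto_atTop_add_const_right _ _ tendsto_id)
    have h1 : Tendsto (fun t : ℝ => s - (s ^ 2 - 1) * (t + s)⁻¹) atTop (𝓝 s) := by
      simpa using (h0.const_mul (s ^ 2 - 1)).const_sub s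
    refine (h1.log hs0.ne').congr' ?_
    filter_upwards [eventually_gt_atTop 0] with t ht
    rw [← Real.log_div (by positivity) (by positivity)]
    congr 1
    field_simp
    ring

/-- Integrating the kernel in `s` over `(1, x]`. -/
lemma integral_logSqKernel_Ioc {x t : ℝ} (hx : 1 ≤ x) (ht : 0 < t) :
    ∫ s in Ioc 1 x, (s ^ 2 - 1) / (s * (t + s) * (1 + t * s))
      = (Real.log (1 + t * x) + Real.log (t + x) - Real.log x - 2 * Real.log (1 + t)) / t := by
  rw [← intervalIntegral.integral_of_le hx]
  rw [intervalIntegral.integral_eq_sub_of_hasDerivAt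
    (f := fun s => (Real.log (1 + t * s) + Real.log (t + s) - Real.log s) / t)]
  · simp only [mul_one, Real.log_one, add_comm t 1]
    ring
  · intro s hs
    rw [uIcc_of_le hx] at hs
    have hs0 : 0 < s := by linarith [hs.1]
    have h1 : 1 + t * s ≠ 0 := by positivity
    have h2 : t + s ≠ 0 := by positivity
    have d1 : HasDerivAt (fun s : ℝ => 1 + t * s) t s := by
      simpa using ((hasDerivAt_id s).const_mul t).const_add 1
    have d2 : HasDerivAt (fun s : ℝ => t + s) 1 s := (hasDerivAt_id s).const_add t
    refine HasDerivAt.congr_deriv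
      ((((d1.log h1).add (d2.log h2)).sub (Real.hasDerivAt_log hs0.ne')).div_const t) ?_
    field_simp
    ring
  · apply ContinuousOn.intervalIntegrable
    rw [uIcc_of_le hx]
    apply ContinuousOn.div (by fun_prop) (by fun_prop)
    intro s hs
    have hs0 : 0 < s := by linarith [hs.1]
    positivity

lemma integrable_logSqKernel (x : ℝ) :
    Integrable (fun p : ℝ × ℝ => (p.2 ^ 2 - 1) / (p.2 * (p.1 + p.2) * (1 + p.1 * p.2)))
      ((volume.restrict (Ioi 0)).prod (volume.restrict (Ioc 1 x))) := by
  have hb : Integrable (fun p : ℝ × ℝ => x * ((1 + p.1) ^ 2)⁻¹)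
      ((volume.restrict (Ioi 0)).prod (volume.restrict (Ioc 1 x))) :=
    (integrableOn_inv_one_add_sq_Ioi.const_mul x).comp_fst _
  refine hb.mono' (Measurable.aestronglyMeasurable (by fun_prop)) ?_
  rw [Measure.prod_restrict]
  filter_upwards [ae_restrict_mem (measurableSet_Ioi.prod measurableSet_Ioc)] with p hp
  rw [Real.norm_of_nonneg (logSqKernel_nonneg hp.2.1.le hp.1)]
  exact logSqKernel_le hp.2.1.le hp.2.2 hp.1

lemma integral_two_mul_log_div {x : ℝ} (hx : 1 ≤ x) :
    ∫ s in Ioc 1 x, 2 * Real.log s / s = Real.log x ^ 2 := by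
  rw [← intervalIntegral.integral_of_le hx]
  rw [intervalIntegral.integral_eq_sub_of_hasDerivAt (f := fun s => Real.log s ^ 2)]
  · simp
  · intro s hs
    rw [uIcc_of_le hx] at hs
    have hs0 : s ≠ 0 := by linarith [hs.1]
    refine HasDerivAt.congr_deriv ((Real.hasDerivAt_log hs0).pow 2) ?_
    field_simp
    norm_num
  · apply ContinuousOn.intervalIntegrable
    rw [uIcc_of_le hx]
    have h : ∀ s ∈ Icc 1 x, s ≠ 0 := fun s hs => by linarith [hs.1]
    exact ContinuousOn.div (continuousOn_const.mul (continuousOn_id.log h)) continuousOn_id h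

lemma integral_log_sq_of_one_le {x : ℝ} (hx : 1 ≤ x) :
    IntegrableOn (fun t : ℝ =>
        (Real.log (1 + t * x) + Real.log (t + x) - Real.log x - 2 * Real.log (1 + t)) / t)
      (Ioi 0) ∧
    ∫ t in Ioi (0 : ℝ),
        (Real.log (1 + t * x) + Real.log (t + x) - Real.log x - 2 * Real.log (1 + t)) / t
      = Real.log x ^ 2 := by
  have hint := integrable_logSqKernel x
  constructor
  · exact IntegrableOn.congr_fun hint.integral_prod_left
      (fun t ht => integral_logSqKernel_Ioc hx ht) measurableSet_Ioi
  · rw [← integral_two_mul_log_div hx,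
      ← setIntegral_congr_fun measurableSet_Ioi (fun t ht => integral_logSqKernel_Ioc hx ht),
      ← setIntegral_congr_fun measurableSet_Ioc
        (fun s (hs : s ∈ Ioc 1 x) => integral_logSqKernel_Ioi hs.1.le)]
    exact integral_integral_swap hint

lemma log_sq_integrand_inv {x t : ℝ} (hx : 0 < x) (ht : 0 < t) :
    (Real.log (1 + t * x⁻¹) + Real.log (t + x⁻¹) - Real.log x⁻¹ - 2 * Real.log (1 + t)) / t
      = (Real.log (1 + t * x) + Real.log (t + x) - Real.log x - 2 * Real.log (1 + t)) / t := by
  have h1 : 1 + t * x⁻¹ = (t + x) / x := by field_simp; ring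
  have h2 : t + x⁻¹ = (1 + t * x) / x := by field_simp; ring
  rw [h1, h2, Real.log_div (by positivity) hx.ne', Real.log_div (by positivity) hx.ne',
    Real.log_inv]
  ring

/-- Integral representation of the squared logarithm: for `x > 0`,
`∫₀^∞ (log(1+tx) + log(t+x) - log x - 2 log(1+t)) dt/t = (log x)²`. -/
theorem statement9 (x : ℝ) (hx : 0 < x) :
    MeasureTheory.IntegrableOn
      (fun t : ℝ =>
        (Real.log (1 + t * x) + Real.log (t + x) - Real.log x
          - 2 * Real.log (1 + t)) / t)
      (Set.Ioi 0) ∧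
    ∫ t in Set.Ioi (0 : ℝ),
        (Real.log (1 + t * x) + Real.log (t + x) - Real.log x
          - 2 * Real.log (1 + t)) / t
      = (Real.log x) ^ 2 := by
  rcases le_total 1 x with h | h
  · exact integral_log_sq_of_one_le h
  · obtain ⟨hi, he⟩ := integral_log_sq_of_one_le ((one_le_inv₀ hx).2 h)
    refine ⟨hi.congr_fun (fun t ht => log_sq_integrand_inv hx ht) measurableSet_Ioi, ?_⟩
    rw [← setIntegral_congr_fun measurableSet_Ioi (fun t ht => log_sq_integrand_inv hx ht), he,
      Real.log_inv, neg_sq]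
end

section
/- Let M be an n×n real symmetric positive definite matrix and let S denote its unique symmetric positive definite square root (S² = M). Then (S + I)⁻¹ + (S + M)⁻¹ = S⁻¹, where I is the n×n identity matrix; that is, the matrix square root M^{1/2} is a fixed point of the iteration X ← (X + I)⁻¹ + (X + M)⁻¹. -/
/-- The matrix square root `M^{1/2}` is a fixed point of the iteration
`X ← (X + I)⁻¹ + (X + M)⁻¹`: if `S` is the symmetric positive definite square root of
the symmetric positive definite matrix `M`, then `(S + I)⁻¹ + (S + M)⁻¹ = S⁻¹`. -/
theorem statement14 (n : ℕ) (M : Matrix (Fin n) (Fin n) ℝ) (hM : M.PosDef)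
    (S : Matrix (Fin n) (Fin n) ℝ) (hS : S.PosDef) (hSsq : S * S = M) :
    (S + 1)⁻¹ + (S + M)⁻¹ = S⁻¹ := by
  have hdetS : IsUnit S.det := hS.det_pos.ne'.isUnit
  have hdetS1 : IsUnit (S + 1).det := (hS.add Matrix.PosDef.one).det_pos.ne'.isUnit
  have hfactor : S + M = S * (S + 1) := by rw [← hSsq, mul_add, mul_one, add_comm]
  calc (S + 1)⁻¹ + (S + M)⁻¹
      = (S + 1)⁻¹ * (S * S⁻¹) + (S + 1)⁻¹ * S⁻¹ := by
        rw [hfactor, Matrix.mul_inv_rev, Matrix.mul_nonsing_inv _ hdetS, mul_one]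
    _ = (S + 1)⁻¹ * (S + 1) * S⁻¹ := by noncomm_ring
    _ = S⁻¹ := by rw [Matrix.nonsing_inv_mul _ hdetS1, one_mul]
end

section
/- Let E be a real inner product space, C ⊆ E, f : E → ℝ, and let h₁, …, h_m : E → ℝ be convex and differentiable; set h := (1/m) Σᵢ hᵢ and φ := f − h. Consider the incremental scheme: anchor points y₁ᵏ, …, y_mᵏ ∈ C and iterates x_k ∈ C satisfy, for each k ≥ 1: an index i_k is chosen, y_{i_k}ᵏ := x_k and yᵢᵏ := yᵢᵏ⁻¹ for i ≠ i_k, and x_{k+1} minimizes over C the surrogate Qᵏ(x) := f(x) − (1/m) Σᵢ [hᵢ(yᵢᵏ) + ⟨∇hᵢ(yᵢᵏ), x − yᵢᵏ⟩]. Then for every k ≥ 1: (i) Qᵏ(x) ≥ φ(x) for all x ∈ C; and (ii) Qᵏ(x_{k+1}) ≤ Qᵏ⁻¹(x_k). Hence the surrogate optimal values Qᵏ(x_{k+1}) form a nonincreasing sequence bounded below by inf_C φ whenever φ is bounded below on C. -/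
open scoped RealInnerProductSpace

/-- The linearization of a convex function at a point of differentiability minorizes it. -/
theorem ConvexOn.add_inner_le_of_hasGradientAt {E : Type*} [NormedAddCommGroup E]
    [InnerProductSpace ℝ E] [CompleteSpace E] {s : Set E} {g : E → ℝ} {v u z : E}
    (hg : ConvexOn ℝ s g) (hu : u ∈ s) (hz : z ∈ s) (hv : HasGradientAt g v u) :
    g u + ⟪v, z - u⟫ ≤ g z := by
  have hline : HasDerivAt (g ∘ AffineMap.lineMap (k := ℝ) u z) ⟪v, z - u⟫ 0 := by
    have hgu := hv.hasFDerivAt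
    rw [← AffineMap.lineMap_apply_zero (k := ℝ) u z] at hgu
    simpa using hgu.comp_hasDerivAt (0 : ℝ) AffineMap.hasDerivAt_lineMap
  have hslope := (hg.comp_affineMap (AffineMap.lineMap u z)).le_slope_of_hasDerivAt
    (x := 0) (y := 1) (by simpa using hu) (by simpa using hz) one_pos hline
  simp only [slope_def_field, Function.comp_apply, AffineMap.lineMap_apply_one,
    AffineMap.lineMap_apply_zero, sub_zero, div_one] at hslope
  linarith

/-- Deterministic core of the incremental Majorization-Minimization scheme for
finite-sum DC problems: with `h = (1/m) Σᵢ hᵢ` and surrogates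
`Qᵏ(z) = f z - (1/m) Σᵢ [hᵢ(yᵢᵏ) + ⟪∇hᵢ(yᵢᵏ), z - yᵢᵏ⟫]` built from anchor points
updated one component at a time to the current iterate, each `Qᵏ` majorizes
`φ = f - h` on `C`, the surrogate optimal values `Qᵏ(x_{k+1})` are nonincreasing,
and they are bounded below by any lower bound of `φ` on `C`. -/
theorem statement16 {E : Type*} [NormedAddCommGroup E] [InnerProductSpace ℝ E]
    [CompleteSpace E]
    (C : Set E) (m : ℕ) (hm : 1 ≤ m)
    (f : E → ℝ) (h : Fin m → E → ℝ) (h' : Fin m → E → E)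
    (hconv : ∀ i, ConvexOn ℝ Set.univ (h i))
    (hdiff : ∀ i, ∀ u : E, HasGradientAt (h i) (h' i u) u)
    (y : ℕ → Fin m → E) (x : ℕ → E) (idx : ℕ → Fin m)
    (hyC : ∀ k i, y k i ∈ C) (hxC : ∀ k, x k ∈ C)
    (hupd : ∀ k : ℕ, 1 ≤ k →
      y k (idx k) = x k ∧ ∀ i, i ≠ idx k → y k i = y (k - 1) i)
    (Q : ℕ → E → ℝ)
    (hQ : ∀ k : ℕ, ∀ z : E,
      Q k z = f z - (1 / m) * ∑ i, (h i (y k i) + ⟪h' i (y k i), z - y k i⟫))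
    (hmin : ∀ k : ℕ, ∀ z ∈ C, Q k (x (k + 1)) ≤ Q k z) :
    (∀ k : ℕ, ∀ z ∈ C, f z - (1 / m) * ∑ i, h i z ≤ Q k z) ∧
    (∀ k : ℕ, 1 ≤ k → Q k (x (k + 1)) ≤ Q (k - 1) (x k)) ∧
    (∀ B : ℝ, (∀ z ∈ C, B ≤ f z - (1 / m) * ∑ i, h i z) →
      ∀ k : ℕ, B ≤ Q k (x (k + 1))) := by
  have hlin : ∀ i u z, h i u + ⟪h' i u, z - u⟫ ≤ h i z := fun i u z =>
    (hconv i).add_inner_le_of_hasGradientAt (Set.mem_univ u) (Set.mem_univ z) (hdiff i u)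
  have hmaj : ∀ k z, f z - (1 / m) * ∑ i, h i z ≤ Q k z := by
    intro k z
    rw [hQ]
    gcongr
    exact hlin _ _ _
  refine ⟨fun k z _ => hmaj k z, fun k hk => (hmin k _ (hxC k)).trans ?_,
    fun B hB k => (hB _ (hxC _)).trans (hmaj _ _)⟩
  rw [hQ, hQ]
  gcongr f (x k) - 1 / m * ∑ i, ?_ with i
  obtain ⟨hnew, hold⟩ := hupd k hk
  by_cases hi : i = idx k
  · subst hi
    simpa [hnew] using hlin (idx k) (y (k - 1) (idx k)) (x k)
  · rw [hold i hi]
end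

section
/- Let E be a real inner product space, C ⊆ E, f : E → ℝ, and h : E → ℝ convex and differentiable. If y ∈ C and x′ ∈ C minimizes the CCCP majorant x ↦ f(x) − h(y) − ⟨∇h(y), x − y⟩ over C, then f(x′) − h(x′) ≤ f(y) − h(y); that is, each exact CCCP step does not increase the objective φ = f − h. -/
open scoped RealInnerProductSpace

/-- A convex function lies above its tangent hyperplane at a point of differentiability. -/
theorem ConvexOn.add_inner_le_of_hasGradientAt_s17 {E : Type*} [NormedAddCommGroup E]
    [InnerProductSpace ℝ E] [CompleteSpace E] {h : E → ℝ} {g x y : E}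
    (hconv : ConvexOn ℝ Set.univ h) (hg : HasGradientAt h g y) :
    h y + ⟪g, x - y⟫ ≤ h x := by
  have hline : ConvexOn ℝ Set.univ (h ∘ AffineMap.lineMap (k := ℝ) y x) :=
    hconv.comp_affineMap (AffineMap.lineMap y x)
  have hderiv : HasDerivAt (h ∘ AffineMap.lineMap (k := ℝ) y x) ⟪g, x - y⟫ 0 := by
    have hF : HasFDerivAt h (InnerProductSpace.toDual ℝ E g)
        (AffineMap.lineMap (k := ℝ) y x 0) := by
      simpa using hg.hasFDerivAt
    simpa using hF.comp_hasDerivAt (0 : ℝ) AffineMap.hasDerivAt_lineMap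
  have hslope := hline.le_slope_of_hasDerivAt (Set.mem_univ 0) (Set.mem_univ 1) one_pos hderiv
  simp [slope_def_field] at hslope
  linarith

/-- Monotone descent of exact CCCP: if `x'` minimizes the majorant
`x ↦ f x - h y - ⟪∇h y, x - y⟫` over `C` and `h` is convex and differentiable, then
`φ(x') ≤ φ(y)` for `φ = f - h`. No smoothness of `h` is required. -/
theorem statement17 {E : Type*} [NormedAddCommGroup E] [InnerProductSpace ℝ E]
    [CompleteSpace E]
    (C : Set E) (f h : E → ℝ) (h' : E → E)
    (hconv : ConvexOn ℝ Set.univ h)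
    (hdiff : ∀ u : E, HasGradientAt h (h' u) u)
    (y : E) (hy : y ∈ C) (x' : E) (hx' : x' ∈ C)
    (hmin : ∀ z ∈ C,
      f x' - h y - ⟪h' y, x' - y⟫ ≤ f z - h y - ⟪h' y, z - y⟫) :
    f x' - h x' ≤ f y - h y := by
  have hself := hmin y hy
  have htangent := hconv.add_inner_le_of_hasGradientAt_s17 (x := x') (hdiff y)
  rw [sub_self, inner_zero_right] at hself
  linarith
end
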